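/- Let (T_n(t))_{t>0}, n ∈ ℕ, be a sequence of positive semigroups of kernel operators on a Polish space E, all bounded by a common constant M, such that each T_n(t) maps C_b(E) into C_b(E), and let (R_n(λ))_{λ>0} denote their Laplace transforms. Then the following are equivalent: (i) for every t > 0 the sequence of operators (T_n(t))_{n∈ℕ} is increasing, i.e. T_n(t) ≤ T_{n+1}(t) for all n; (ii) for every λ > 0 the sequence (R_n(λ))_{n∈ℕ} is increasing, i.e. R_n(λ) ≤ R_{n+1}(λ) for all n. -/

import Mathlib

open MeasureTheory Filter Topology

/-- `f` is a bounded Borel measurable real-valued function. -/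
def IsBb {E : Type*} [MeasurableSpace E] (f : E → ℝ) : Prop :=
  Measurable f ∧ ∃ C : ℝ, ∀ x, |f x| ≤ C

/-- `f` is a bounded continuous real-valued function. -/
def IsCb {E : Type*} [TopologicalSpace E] (f : E → ℝ) : Prop :=
  Continuous f ∧ ∃ C : ℝ, ∀ x, |f x| ≤ C

/-- The kernel operator associated with a kernel `k : E → Measure E`. -/
noncomputable def kOp {E : Type*} [MeasurableSpace E] (k : E → Measure E) (f : E → ℝ) (x : E) : ℝ :=
  ∫ y, f y ∂(k x)

/-- `(k t)_{t>0}` is a positive semigroup of kernels on `E`, bounded by `M`: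
measurability in `x`, total mass bounded by `M`, Chapman–Kolmogorov, and joint
measurability of `(t,x) ↦ (T(t)f)(x)` on `(0,∞) × E` for bounded measurable `f`. -/
def IsKernelSemigroup {E : Type*} [MeasurableSpace E] (k : ℝ → E → Measure E) (M : NNReal) : Prop :=
  (∀ t, 0 < t → ∀ A : Set E, MeasurableSet A → Measurable fun x => k t x A) ∧
  (∀ t, 0 < t → ∀ x, k t x Set.univ ≤ (M : ENNReal)) ∧
  (∀ t, 0 < t → ∀ s, 0 < s → ∀ x, ∀ A : Set E, MeasurableSet A →
    k (t + s) x A = ∫⁻ y, k s y A ∂(k t x)) ∧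
  (∀ f : E → ℝ, IsBb f → Measurable fun p : Set.Ioi (0:ℝ) × E => kOp (k p.1.1) f p.2)

/-- The Laplace transform (pseudo-resolvent) of the semigroup of kernel operators. -/
noncomputable def laplaceOp {E : Type*} [MeasurableSpace E]
    (k : ℝ → E → Measure E) (l : ℝ) (f : E → ℝ) (x : E) : ℝ :=
  ∫ t in Set.Ioi (0:ℝ), Real.exp (-l * t) * kOp (k t) f x

open Set BoundedContinuousFunction
open scoped ENNReal NNReal

theorem measure_le_of_forall_lintegral_le {X : Type*} [TopologicalSpace X] [MeasurableSpace X]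
    [BorelSpace X] [TopologicalSpace.PseudoMetrizableSpace X] {μ ν : Measure X}
    [IsFiniteMeasure μ] [IsFiniteMeasure ν]
    (h : ∀ f : X →ᵇ ℝ≥0, ∫⁻ x, f x ∂μ ≤ ∫⁻ x, f x ∂ν) : μ ≤ ν := by
  let := TopologicalSpace.pseudoMetrizableSpacePseudoMetric X
  have hclosed : ∀ F : Set X, IsClosed F → μ F ≤ ν F := fun F hF =>
    ge_of_tendsto' (HasOuterApproxClosed.tendsto_lintegral_apprSeq hF ν) fun n =>
      (HasOuterApproxClosed.measure_le_lintegral hF μ n).trans (h _)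
  refine Measure.le_iff.2 fun s hs => ?_
  refine ENNReal.le_of_forall_pos_le_add fun ε hε _ => ?_
  obtain ⟨K, hKs, hK, hlt⟩ := hs.exists_isClosed_lt_add (measure_ne_top μ s)
    (ENNReal.coe_ne_zero.2 hε.ne')
  exact hlt.le.trans 
    (add_le_add ((hclosed K hK).trans (measure_mono hKs)) le_rfl)

/-- Convergence on a suitable countable family of Borel sets implies weak convergence. -/
theorem exists_countable_convergence_determining (X : Type*) [TopologicalSpace X]
    [SecondCountableTopology X] [MeasurableSpace X] [OpensMeasurableSpace X] :
    ∃ 𝒞 : Set (Set X), 𝒞.Countable ∧ (∀ B ∈ 𝒞, MeasurableSet B) ∧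
      ∀ (μs : ℕ → Measure X) (μ : Measure X) [IsFiniteMeasure μ],
        (∀ B ∈ 𝒞, Tendsto (fun n => μs n B) atTop (𝓝 (μ B))) →
        ∀ f : X →ᵇ ℝ≥0, Tendsto (fun n => ∫⁻ x, f x ∂μs n) atTop (𝓝 (∫⁻ x, f x ∂μ)) := by
  classical
  let b := TopologicalSpace.countableBasis X
  have hb := TopologicalSpace.isBasis_countableBasis X
  have hbc : Countable b := (TopologicalSpace.countable_countableBasis X).to_subtype
  let B : Finset b → Set X := fun F => ⋃ i ∈ F, (i : Set X)
  have hBo : ∀ F, IsOpen (B F) := fun F =>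
    isOpen_biUnion fun i _ => hb.isOpen i.2
  refine ⟨insert univ (range B), (countable_range B).insert _, ?_, ?_⟩
  · rintro _ (rfl | ⟨F, rfl⟩)
    exacts [MeasurableSet.univ, (hBo F).measurableSet]
  intro μs μ _ h
  have hopen : ∀ G, IsOpen G → μ G ≤ atTop.liminf fun n => μs n G := by
    intro G hG
    let t : Set (Finset b) := {F | B F ⊆ G}
    have hGt : G = ⋃ F ∈ t, B F := by
      apply Subset.antisymm
      · intro x hx
        obtain ⟨v, hv, hxv, hvG⟩ := hb.exists_subset_of_mem_open hx hG
        refine mem_iUnion₂.2 ⟨{⟨v, hv⟩}, ?_, ?_⟩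
        · simpa [t, B] using fun (w : Set X) (_ : w ∈ b) (h : w = v) => h ▸ hvG
        · simpa [B] using ⟨hv, hxv⟩
      · exact iUnion₂_subset fun F hF => hF
    have hμ : μ G = ⨆ F ∈ t, μ (B F) := by
      conv_lhs => rw [hGt]
      refine measure_biUnion_eq_iSup (to_countable t) ?_
      intro F hF F' hF'
      refine ⟨F ∪ F', ?_, ?_, ?_⟩
      · simp only [t, B, mem_ofPred_eq, Finset.mem_union, iUnion_subset_iff] at hF hF' ⊢
        rintro i (hi | hi)
        exacts [hF i hi, hF' i hi]
      · exact biUnion_subset_biUnion_left fun i hi => Finset.mem_union_left _ hi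
      · exact biUnion_subset_biUnion_left fun i hi => Finset.mem_union_right _ hi
    rw [hμ]
    refine iSup₂_le fun F hF => ?_
    rw [← (h (B F) (mem_insert_of_mem _ ⟨F, rfl⟩)).liminf_eq]
    exact liminf_le_liminf (Eventually.of_forall fun n => measure_mono hF)
  have hlim : ∀ f : X →ᵇ ℝ≥0, ∫⁻ x, f x ∂μ ≤ atTop.liminf fun n => ∫⁻ x, f x ∂μs n := by
    intro f
    simpa using lintegral_le_liminf_lintegral_of_forall_isOpen_measure_le_liminf_measure
      (μ := μ) (μs := μs) (f := fun x => (f x : ℝ)) (by fun_prop) (fun x => (f x).2) hopen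
  intro f
  let g : X →ᵇ ℝ≥0 := BoundedContinuousFunction.const X (nndist f 0) - f
  have hfg : ∀ ν : Measure X, ∫⁻ x, f x ∂ν + ∫⁻ x, g x ∂ν = nndist f 0 * ν univ := by
    intro ν
    rw [← lintegral_add_left (by fun_prop), ← lintegral_const]
    refine lintegral_congr fun x => ?_
    rw [← ENNReal.coe_add]
    have : f x ≤ nndist f 0 := BoundedContinuousFunction.NNReal.upper_bound f x
    simp [g, this]
  have hfin : ∀ f : X →ᵇ ℝ≥0, ∫⁻ x, f x ∂μ ≠ ∞ := fun f =>
    (BoundedContinuousFunction.lintegral_lt_top_of_nnreal μ f).ne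
  have hev : ∀ (f : X →ᵇ ℝ≥0) (ε : ℝ≥0∞), ε ≠ 0 →
      ∀ᶠ n in atTop, ∫⁻ x, f x ∂μ ≤ ∫⁻ x, f x ∂μs n + ε := by
    intro f ε hε
    rcases eq_or_ne (∫⁻ x, f x ∂μ) 0 with h0 | h0
    · simp [h0]
    · have := eventually_lt_of_lt_liminf ((ENNReal.sub_lt_self (hfin f) h0 hε).trans_le (hlim f))
      filter_upwards [this] with n hn
      exact tsub_le_iff_right.1 hn.le
  have hmass := ENNReal.Tendsto.const_mul (a := nndist f 0) (h univ (mem_insert _ _))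
    (Or.inr ENNReal.coe_ne_top)
  rw [ENNReal.tendsto_nhds (ENNReal.mul_ne_top ENNReal.coe_ne_top (measure_ne_top μ _))] at hmass
  rw [ENNReal.tendsto_nhds (hfin f)]
  intro ε hε
  have hε2 : ε / 2 ≠ 0 := by simpa using hε.ne'
  filter_upwards [hev f ε hε.ne', hev g _ hε2, hmass (ε / 2) (pos_iff_ne_zero.2 hε2)]
    with n h1 h2 h3
  refine ⟨tsub_le_iff_right.2 h1, ?_⟩
  refine (ENNReal.add_le_add_iff_right (hfin g)).1 ?_
  calc ∫⁻ x, f x ∂μs n + ∫⁻ x, g x ∂μ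
      ≤ ∫⁻ x, f x ∂μs n + (∫⁻ x, g x ∂μs n + ε / 2) := by gcongr
    _ = nndist f 0 * μs n univ + ε / 2 := by rw [← add_assoc, hfg]
    _ ≤ nndist f 0 * μ univ + ε / 2 + ε / 2 := by gcongr; exact h3.2
    _ = ∫⁻ x, f x ∂μ + ε + ∫⁻ x, g x ∂μ := by
      rw [← hfg, add_assoc, ENNReal.add_halves]; ring

theorem ae_exists_seq_tendsto {X : Type*} [TopologicalSpace X] [SecondCountableTopology X]
    [MeasurableSpace X] [BorelSpace X] {Φ : ℝ → X} (hΦ : Measurable Φ) :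
    ∀ᵐ s : ℝ, ∀ p : ℝ → Prop, (∀ᵐ t, p t) →
      ∃ u : ℕ → ℝ, Tendsto u atTop (𝓝 s) ∧ Tendsto (Φ ∘ u) atTop (𝓝 (Φ s)) ∧ ∀ n, p (u n) := by
  have hΨ : Measurable fun t => (t, Φ t) := by fun_prop
  have := Measure.support_mem_ae (μ := Measure.map (fun t => (t, Φ t)) volume)
  filter_upwards [ae_of_ae_map hΨ.aemeasurable this] with s hs p hp
  replace hs := (Measure.mem_support_iff_forall _).1 hs
  have hf : ∃ᶠ t in comap (fun t => (t, Φ t)) (𝓝 (s, Φ s)), p t := by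
    rw [frequently_comap, frequently_iff]
    intro U hU
    obtain ⟨V, hVU, hVo, hsV⟩ := mem_nhds_iff.1 hU
    have hpos := hs V (hVo.mem_nhds hsV)
    rw [Measure.map_apply hΨ hVo.measurableSet] at hpos
    obtain ⟨t, htV, ht⟩ := (frequently_ae_mem_iff.2 hpos.ne').and_eventually hp |>.exists
    exact ⟨_, hVU htV, t, rfl, ht⟩
  obtain ⟨u, hu, hpu⟩ := exists_seq_forall_of_frequently hf
  rw [tendsto_comap_iff] at hu
  exact ⟨u, (continuous_fst.tendsto _).comp hu, (continuous_snd.tendsto _).comp hu, hpu⟩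

/-- The weight `e^{-lt} (1 - e^{-t})^m`, with values in `ℝ≥0∞`. -/
noncomputable def laplaceWeight (l : ℝ) (m : ℕ) (t : ℝ) : ℝ≥0∞ :=
  ENNReal.ofReal (Real.exp (-l * t) * (1 - Real.exp (-t)) ^ m)

@[fun_prop]
theorem measurable_laplaceWeight (l : ℝ) (m : ℕ) : Measurable (laplaceWeight l m) := by
  unfold laplaceWeight; fun_prop

theorem setLIntegral_laplaceWeight_zero_lt_top {l : ℝ} (hl : 0 < l) :
    ∫⁻ t in Ioi 0, laplaceWeight l 0 t < ∞ := by
  simpa [laplaceWeight] using (exp_neg_integrableOn_Ioi 0 hl).lintegral_lt_top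

theorem setLIntegral_laplaceWeight_zero_mul_lt_top {l : ℝ} (hl : 0 < l) {a : ℝ → ℝ≥0∞} {C : ℝ≥0}
    (ha : ∀ t, a t ≤ C) : ∫⁻ t in Ioi 0, laplaceWeight l 0 t * a t < ∞ := by
  refine (lintegral_mono fun t => mul_le_mul_right (ha t) _).trans_lt ?_
  rw [lintegral_mul_const _ (by fun_prop)]
  exact ENNReal.mul_lt_top (setLIntegral_laplaceWeight_zero_lt_top hl) ENNReal.coe_lt_top

theorem lintegral_le_of_forall_pow_mul_pow {μ ν : Measure unitInterval} [IsFiniteMeasure μ]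
    [IsFiniteMeasure ν]
    (h : ∀ j m : ℕ, ∫⁻ u : unitInterval, ENNReal.ofReal ((u : ℝ) ^ j * (1 - (u : ℝ)) ^ m) ∂μ ≤
      ∫⁻ u : unitInterval, ENNReal.ofReal ((u : ℝ) ^ j * (1 - (u : ℝ)) ^ m) ∂ν) : μ ≤ ν := by
  have hint : ∀ (ρ : Measure unitInterval) [IsFiniteMeasure ρ] (g : C(unitInterval, ℝ)),
      Integrable g ρ := fun ρ _ g =>
    g.continuous.integrable_of_hasCompactSupport (HasCompactSupport.of_compactSpace g)
  have hbern : ∀ n k, ∫ u, bernstein n k u ∂μ ≤ ∫ u, bernstein n k u ∂ν := by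
    intro n k
    have key : ∀ (ρ : Measure unitInterval) [IsFiniteMeasure ρ], ∫ u, bernstein n k u ∂ρ =
        n.choose k * (∫⁻ u : unitInterval,
          ENNReal.ofReal ((u : ℝ) ^ k * (1 - (u : ℝ)) ^ (n - k)) ∂ρ).toReal := by
      intro ρ _
      simp_rw [bernstein_apply, mul_assoc]
      rw [integral_const_mul, integral_eq_lintegral_of_nonneg_ae]
      · exact Eventually.of_forall fun u =>
          mul_nonneg (pow_nonneg u.2.1 _) (pow_nonneg (sub_nonneg.2 u.2.2) _)
      · exact Continuous.aestronglyMeasurable (by fun_prop)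
    rw [key, key]
    refine mul_le_mul_of_nonneg_left (ENNReal.toReal_mono ?_ (h _ _)) (Nat.cast_nonneg _)
    exact (hint ν ⟨fun u : unitInterval => (u : ℝ) ^ k * (1 - (u : ℝ)) ^ (n - k),
      by fun_prop⟩).lintegral_lt_top.ne
  have hlim : ∀ (ρ : Measure unitInterval) [IsFiniteMeasure ρ] (g : C(unitInterval, ℝ)),
      Tendsto (fun n => ∫ u, bernsteinApproximation n g u ∂ρ) atTop (𝓝 (∫ u, g u ∂ρ)) := by
    intro ρ _ g
    have hg := bernsteinApproximation_uniform g
    refine tendsto_integral_filter_of_norm_le_const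
      (Eventually.of_forall fun n => (hint ρ _).aestronglyMeasurable) ?_
      (Eventually.of_forall fun u => ((continuous_eval_const u).tendsto g).comp hg)
    obtain ⟨C, hC⟩ := hg.norm.isBoundedUnder_le
    refine ⟨C, (eventually_map.1 hC).mono fun n hn => Eventually.of_forall fun u => ?_⟩
    exact (ContinuousMap.norm_coe_le_norm _ u).trans hn
  refine measure_le_of_forall_lintegral_le fun f => ?_
  let F : C(unitInterval, ℝ) := ⟨fun u => (f u : ℝ), by fun_prop⟩
  have hF : ∫ u, F u ∂μ ≤ ∫ u, F u ∂ν := by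
    refine le_of_tendsto_of_tendsto' (hlim μ F) (hlim ν F) fun n => ?_
    have hs : ∀ (k : Fin (n + 1)) (ρ : Measure unitInterval) [IsFiniteMeasure ρ],
        Integrable (fun u => bernstein n k u • F (bernstein.z k)) ρ := fun k ρ _ =>
      (hint ρ _).smul_const _
    simp_rw [bernsteinApproximation.apply]
    rw [integral_finsetSum _ fun k _ => hs k μ, integral_finsetSum _ fun k _ => hs k ν]
    refine Finset.sum_le_sum fun k _ => ?_
    rw [integral_smul_const, integral_smul_const]
    exact mul_le_mul_of_nonneg_right (hbern n k) (f _).2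
  have hconv : ∀ (ρ : Measure unitInterval) [IsFiniteMeasure ρ],
      ∫⁻ u, f u ∂ρ = ENNReal.ofReal (∫ u, F u ∂ρ) := by
    intro ρ _
    rw [ofReal_integral_eq_lintegral_ofReal (hint ρ F) (Eventually.of_forall fun u => (f u).2)]
    simp [F]
  rw [hconv, hconv]
  exact ENNReal.ofReal_le_ofReal hF

/-- Inversion of the Laplace transform as an order statement. -/
theorem ae_le_of_setLIntegral_laplaceWeight_le {a b : ℝ → ℝ≥0∞} (ha : Measurable a)
    (hb : Measurable b) {C : ℝ≥0} (haC : ∀ t, a t ≤ C) (hbC : ∀ t, b t ≤ C)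
    (h : ∀ j m : ℕ, ∫⁻ t in Ioi 0, laplaceWeight (j + 1) m t * a t ≤
      ∫⁻ t in Ioi 0, laplaceWeight (j + 1) m t * b t) :
    ∀ᵐ t : ℝ, 0 < t → a t ≤ b t := by
  let φ : ℝ → unitInterval := fun t => projIcc 0 1 zero_le_one (Real.exp (-t))
  have hφ : Measurable φ := (continuous_projIcc.comp (by fun_prop)).measurable
  have hφe : ∀ t, 0 < t → (φ t : ℝ) = Real.exp (-t) := fun t ht => by
    simp [φ, projIcc, Real.exp_nonneg, ht.le]
  let η : (ℝ → ℝ≥0∞) → Measure ℝ := fun c =>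
    (volume.restrict (Ioi 0)).withDensity fun t => laplaceWeight 1 0 t * c t
  have hfin : ∀ c : ℝ → ℝ≥0∞, (∀ t, c t ≤ C) → IsFiniteMeasure (η c) := fun c hc =>
    isFiniteMeasure_withDensity (setLIntegral_laplaceWeight_zero_mul_lt_top one_pos hc).ne
  have := hfin a haC
  have := hfin b hbC
  have hmom : ∀ c : ℝ → ℝ≥0∞, Measurable c → ∀ j m : ℕ,
      ∫⁻ u : unitInterval, ENNReal.ofReal ((u : ℝ) ^ j * (1 - (u : ℝ)) ^ m) ∂(η c).map φ =
        ∫⁻ t in Ioi 0, laplaceWeight (j + 1) m t * c t := by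
    intro c hc j m
    rw [lintegral_map (by fun_prop) hφ,
      lintegral_withDensity_eq_lintegral_mul _ (by fun_prop) (by fun_prop)]
    refine setLIntegral_congr_fun measurableSet_Ioi fun t ht => ?_
    simp only [Pi.mul_apply, laplaceWeight, hφe t ht]
    rw [mul_right_comm, ← ENNReal.ofReal_mul (by positivity)]
    congr 2
    rw [← Real.exp_nat_mul, pow_zero, mul_one, ← mul_assoc, ← Real.exp_add]
    ring_nf
  have hle : (η a).map φ ≤ (η b).map φ := by
    refine lintegral_le_of_forall_pow_mul_pow fun j m => ?_
    rw [hmom a ha, hmom b hb]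
    exact h j m
  let ψ : unitInterval → ℝ := fun u => -Real.log u
  have hψ : Measurable ψ := by fun_prop
  have hψφ : ∀ c, ((η c).map φ).map ψ = η c := by
    intro c
    rw [Measure.map_map hψ hφ]
    conv_rhs => rw [← Measure.map_id (μ := η c)]
    refine Measure.map_congr ?_
    have : ∀ᵐ t ∂volume.restrict (Ioi (0 : ℝ)), (ψ ∘ φ) t = id t := by
      filter_upwards [ae_restrict_mem measurableSet_Ioi] with t ht
      simp [ψ, hφe t ht]
    exact (withDensity_absolutelyContinuous _ _).ae_le this
  have hη : η a ≤ η b := by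
    rw [← hψφ a, ← hψφ b]
    exact Measure.map_mono hle hψ
  have hae : (fun t => laplaceWeight 1 0 t * a t) ≤ᵐ[volume.restrict (Ioi 0)]
      fun t => laplaceWeight 1 0 t * b t := by
    refine ae_le_of_forall_setLIntegral_le_of_sigmaFinite (by fun_prop) fun s hs _ => ?_
    rw [← withDensity_apply _ hs, ← withDensity_apply _ hs]
    exact hη s
  filter_upwards [(ae_restrict_iff' measurableSet_Ioi).1 hae] with t ht ht0
  refine (ENNReal.mul_le_mul_iff_right ?_ ENNReal.ofReal_ne_top).1 (ht ht0)
  simp [Real.exp_pos]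

/-- A jointly measurable family of uniformly bounded kernels indexed by `ℝ`, zero for `t ≤ 0`,
with the semigroup property for positive times. -/
structure IsMeasurableSemigroup {E : Type*} [MeasurableSpace E] (κ : ℝ → E → Measure E)
    (M : ℝ≥0) : Prop where
  measurable : Measurable fun p : ℝ × E => κ p.1 p.2
  mass_le : ∀ t x, κ t x univ ≤ M
  eq_zero : ∀ t, t ≤ 0 → ∀ x, κ t x = 0
  add : ∀ t, 0 < t → ∀ s, 0 < s → ∀ x, κ (t + s) x = (κ t x).bind (κ s)

/-- The time average `∫ w(t) κ_t(x, ·) dt`. -/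
noncomputable def weightedKernel {E : Type*} [MeasurableSpace E] (κ : ℝ → E → Measure E)
    (w : ℝ → ℝ≥0∞) (x : E) : Measure E :=
  (volume.withDensity w).bind fun t => κ t x

namespace IsMeasurableSemigroup

variable {E : Type*} [MeasurableSpace E] {κ κ' : ℝ → E → Measure E} {M M' : ℝ≥0}
  {w e : ℝ → ℝ≥0∞} {f : E → ℝ≥0∞}

theorem measurable_right (h : IsMeasurableSemigroup κ M) (t : ℝ) : Measurable (κ t) :=
  h.measurable.comp measurable_prodMk_left

theorem measurable_left (h : IsMeasurableSemigroup κ M) (x : E) : Measurable fun t => κ t x :=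
  h.measurable.comp measurable_prodMk_right

theorem measurable_lintegral (h : IsMeasurableSemigroup κ M) (hf : Measurable f) :
    Measurable fun p : ℝ × E => ∫⁻ y, f y ∂κ p.1 p.2 :=
  (Measure.measurable_lintegral hf).comp h.measurable

theorem measurable_lintegral_left (h : IsMeasurableSemigroup κ M) (hf : Measurable f) (x : E) :
    Measurable fun t => ∫⁻ y, f y ∂κ t x :=
  (h.measurable_lintegral hf).comp measurable_prodMk_right

theorem measurable_lintegral_right (h : IsMeasurableSemigroup κ M) (hf : Measurable f) (t : ℝ) :
    Measurable fun x => ∫⁻ y, f y ∂κ t x :=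
  (h.measurable_lintegral hf).comp measurable_prodMk_left

theorem lintegral_le (h : IsMeasurableSemigroup κ M) {C : ℝ≥0∞} (hf : ∀ x, f x ≤ C) (t : ℝ)
    (x : E) : ∫⁻ y, f y ∂κ t x ≤ C * M := by
  refine (lintegral_mono hf).trans ?_
  rw [lintegral_const]
  gcongr
  exact h.mass_le t x

theorem isFiniteMeasure (h : IsMeasurableSemigroup κ M) (t : ℝ) (x : E) :
    IsFiniteMeasure (κ t x) :=
  ⟨(h.mass_le t x).trans_lt ENNReal.coe_lt_top⟩

theorem lintegral_add (h : IsMeasurableSemigroup κ M) (hf : Measurable f) {t s : ℝ} (ht : 0 < t)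
    (hs : 0 < s) (x : E) :
    ∫⁻ y, f y ∂κ (t + s) x = ∫⁻ y, ∫⁻ z, f z ∂κ s y ∂κ t x := by
  rw [h.add t ht s hs, Measure.lintegral_bind (h.measurable_right s).aemeasurable hf.aemeasurable]

theorem lintegral_weightedKernel (h : IsMeasurableSemigroup κ M) (hw : Measurable w)
    (hf : Measurable f) (x : E) :
    ∫⁻ y, f y ∂weightedKernel κ w x = ∫⁻ t in Ioi 0, w t * ∫⁻ y, f y ∂κ t x := by
  rw [weightedKernel,
    Measure.lintegral_bind (h.measurable_left x).aemeasurable hf.aemeasurable,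
    lintegral_withDensity_eq_lintegral_mul _ hw (h.measurable_lintegral_left hf x), ← lintegral_indicator measurableSet_Ioi]
  refine lintegral_congr fun t => ?_
  by_cases ht : t ∈ Ioi (0 : ℝ)
  · simp [ht]
  · simp [ht, h.eq_zero t (not_lt.1 ht)]

theorem measurable_lintegral_weightedKernel (h : IsMeasurableSemigroup κ M) (hw : Measurable w)
    (hf : Measurable f) : Measurable fun x => ∫⁻ y, f y ∂weightedKernel κ w x := by
  simp_rw [h.lintegral_weightedKernel hw hf]
  exact Measurable.lintegral_prod_right' (f := fun p : E × ℝ => w p.2 * ∫⁻ y, f y ∂κ p.2 p.1)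
    ((hw.comp measurable_snd).mul ((h.measurable_lintegral hf).comp measurable_swap))

theorem lintegral_weightedKernel_comp (h : IsMeasurableSemigroup κ M) (he : Measurable e)
    (hw : Measurable w) (hf : Measurable f) (x : E) :
    ∫⁻ y, ∫⁻ z, f z ∂weightedKernel κ w y ∂weightedKernel κ e x =
      ∫⁻ u in Ioi 0, (∫⁻ t in Ioo 0 u, e t * w (u - t)) * ∫⁻ y, f y ∂κ u x := by
  have hF := h.measurable_lintegral_left hf x
  have := fun t => h.isFiniteMeasure t x
  have hinner : ∀ t ∈ Ioi (0 : ℝ), e t * ∫⁻ y, ∫⁻ z, f z ∂weightedKernel κ w y ∂κ t x =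
      ∫⁻ u in Ioi 0, (Ioo 0 u).indicator (fun t => e t * w (u - t)) t * ∫⁻ y, f y ∂κ u x := by
    intro t ht
    simp_rw [h.lintegral_weightedKernel hw hf]
    rw [lintegral_lintegral_swap]
    swap
    · exact ((hw.comp measurable_snd).mul
        ((h.measurable_lintegral hf).comp measurable_swap)).aemeasurable
    have h1 : ∀ s ∈ Ioi (0 : ℝ), ∫⁻ y, w s * ∫⁻ z, f z ∂κ s y ∂κ t x =
        w s * ∫⁻ y, f y ∂κ (s + t) x := by
      intro s hs
      rw [lintegral_const_mul _ (h.measurable_lintegral_right hf s),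
        add_comm, h.lintegral_add hf ht hs]
    have hm : Measurable fun s => w s * ∫⁻ y, f y ∂κ (s + t) x :=
      hw.mul (hF.comp (measurable_add_const t))
    rw [setLIntegral_congr_fun measurableSet_Ioi h1, ← lintegral_const_mul _ hm,
      ← lintegral_indicator measurableSet_Ioi, ← lintegral_indicator measurableSet_Ioi,
      ← lintegral_sub_right_eq_self _ t]
    refine lintegral_congr fun u => ?_
    have ht' : 0 < t := ht
    by_cases hu : t < u
    · simp [hu, ht', ht'.trans hu, mul_assoc]
    · simp [hu, Set.indicator]
  rw [h.lintegral_weightedKernel he (h.measurable_lintegral_weightedKernel hw hf),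
    setLIntegral_congr_fun measurableSet_Ioi hinner, lintegral_lintegral_swap]
  · refine setLIntegral_congr_fun measurableSet_Ioi fun u _ => ?_
    have hm : Measurable fun t => e t * w (u - t) := by fun_prop
    rw [lintegral_mul_const _ (hm.indicator measurableSet_Ioo), lintegral_indicator measurableSet_Ioo,
      Measure.restrict_restrict measurableSet_Ioo, inter_eq_left.2 Ioo_subset_Ioi_self]
  · have hset : MeasurableSet {p : ℝ × ℝ | 0 < p.1 ∧ p.1 < p.2} :=
      (measurableSet_lt measurable_const measurable_fst).inter
        (measurableSet_lt measurable_fst measurable_snd)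
    have hm : Measurable fun p : ℝ × ℝ => e p.1 * w (p.2 - p.1) := by fun_prop
    exact ((hm.indicator hset).mul (hF.comp measurable_snd)).aemeasurable

theorem weightedKernel_comp_le (h : IsMeasurableSemigroup κ M) (h' : IsMeasurableSemigroup κ' M')
    (he : Measurable e) (hw : Measurable w)
    (hle : ∀ x, weightedKernel κ e x ≤ weightedKernel κ' e x)
    (hlw : ∀ x, weightedKernel κ w x ≤ weightedKernel κ' w x) (hf : Measurable f) (x : E) :
    ∫⁻ u in Ioi 0, (∫⁻ t in Ioo 0 u, e t * w (u - t)) * ∫⁻ y, f y ∂κ u x ≤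
      ∫⁻ u in Ioi 0, (∫⁻ t in Ioo 0 u, e t * w (u - t)) * ∫⁻ y, f y ∂κ' u x := by
  rw [← h.lintegral_weightedKernel_comp he hw hf, ← h'.lintegral_weightedKernel_comp he hw hf]
  exact lintegral_mono' (hle x) fun y => lintegral_mono' (hlw y) le_rfl

end IsMeasurableSemigroup

theorem setLIntegral_laplaceWeight_convolution (l : ℝ) (m : ℕ) {u : ℝ} (hu : 0 < u) :
    ∫⁻ t in Ioo 0 u, laplaceWeight l 0 t * laplaceWeight (l + 1) m (u - t) =
      ENNReal.ofReal ((m + 1 : ℝ)⁻¹) * laplaceWeight l (m + 1) u := by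
  have hderiv : ∀ t ∈ uIcc 0 u, HasDerivAt
      (fun t => -(Real.exp (-l * u) * ((m + 1 : ℝ)⁻¹ * (1 - Real.exp (-(u - t))) ^ (m + 1))))
      (Real.exp (-l * t) * (Real.exp (-(l + 1) * (u - t)) * (1 - Real.exp (-(u - t))) ^ m)) t := by
    intro t _
    have h1 : HasDerivAt (fun t => 1 - Real.exp (-(u - t))) (-(Real.exp (-(u - t)) * 1)) t := by
      have : HasDerivAt (fun t => -(u - t)) 1 t := by
        simpa [neg_sub] using (hasDerivAt_id' t).sub_const u
      exact this.exp.const_sub 1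
    convert! (((h1.pow (m + 1)).const_mul ((m + 1 : ℝ)⁻¹)).const_mul (Real.exp (-l * u))).neg using 1
    have : Real.exp (-l * t) * Real.exp (-(l + 1) * (u - t)) =
        Real.exp (-l * u) * Real.exp (-(u - t)) := by
      rw [← Real.exp_add, ← Real.exp_add]; ring_nf
    have hm : (m + 1 : ℝ) ≠ 0 := by positivity
    push_cast
    rw [← mul_assoc, this]
    field_simp
  have hnn : ∀ t ∈ Ioo 0 u, 0 ≤ Real.exp (-l * t) *
      (Real.exp (-(l + 1) * (u - t)) * (1 - Real.exp (-(u - t))) ^ m) := fun t ht => by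
    have : 0 ≤ 1 - Real.exp (-(u - t)) := by
      rw [sub_nonneg, Real.exp_le_one_iff]; linarith [ht.2]
    positivity
  have hcont : Continuous fun t => Real.exp (-l * t) *
      (Real.exp (-(l + 1) * (u - t)) * (1 - Real.exp (-(u - t))) ^ m) := by fun_prop
  have hint := intervalIntegral.integral_eq_sub_of_hasDerivAt hderiv
    (hcont.intervalIntegrable 0 u)
  rw [intervalIntegral.integral_of_le hu.le, integral_Ioc_eq_integral_Ioo] at hint
  calc ∫⁻ t in Ioo 0 u, laplaceWeight l 0 t * laplaceWeight (l + 1) m (u - t)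
      = ∫⁻ t in Ioo 0 u, ENNReal.ofReal (Real.exp (-l * t) *
          (Real.exp (-(l + 1) * (u - t)) * (1 - Real.exp (-(u - t))) ^ m)) := by
        refine lintegral_congr fun t => ?_
        rw [laplaceWeight, laplaceWeight, pow_zero, mul_one,
          ← ENNReal.ofReal_mul (Real.exp_nonneg _)]
    _ = ENNReal.ofReal (∫ t in Ioo 0 u, Real.exp (-l * t) *
          (Real.exp (-(l + 1) * (u - t)) * (1 - Real.exp (-(u - t))) ^ m)) := by
        rw [ofReal_integral_eq_lintegral_ofReal]
        · exact (hcont.continuousOn.integrableOn_Icc).mono_set Ioo_subset_Icc_self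
        · exact (ae_restrict_mem measurableSet_Ioo).mono hnn
    _ = _ := by
        rw [hint, laplaceWeight, ← ENNReal.ofReal_mul (by positivity)]
        congr 1
        simp
        ring

namespace IsMeasurableSemigroup

variable {E : Type*} [MeasurableSpace E] {κ κ' : ℝ → E → Measure E} {M M' : ℝ≥0}

theorem weightedKernel_laplaceWeight_le (h : IsMeasurableSemigroup κ M)
    (h' : IsMeasurableSemigroup κ' M')
    (h0 : ∀ l, 0 < l → ∀ x,
      weightedKernel κ (laplaceWeight l 0) x ≤ weightedKernel κ' (laplaceWeight l 0) x)
    (m : ℕ) : ∀ l, 0 < l → ∀ x,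
      weightedKernel κ (laplaceWeight l m) x ≤ weightedKernel κ' (laplaceWeight l m) x := by
  induction m with
  | zero => exact h0
  | succ m ih =>
    intro l hl x
    refine Measure.le_iff.2 fun s hs => ?_
    have hf : Measurable (s.indicator (1 : E → ℝ≥0∞)) := measurable_one.indicator hs
    have key := h.weightedKernel_comp_le h' (measurable_laplaceWeight l 0)
      (measurable_laplaceWeight (l + 1) m) (h0 l hl) (ih (l + 1) (by linarith)) hf x
    have hconv : ∀ {ρ : ℝ → E → Measure E} {N : ℝ≥0}, IsMeasurableSemigroup ρ N →
        ∫⁻ u in Ioi 0, (∫⁻ t in Ioo 0 u, laplaceWeight l 0 t * laplaceWeight (l + 1) m (u - t)) *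
          ∫⁻ y, s.indicator 1 y ∂ρ u x =
        ENNReal.ofReal ((m + 1 : ℝ)⁻¹) * weightedKernel ρ (laplaceWeight l (m + 1)) x s := by
      intro ρ N hρ
      have hm : Measurable fun t => laplaceWeight l (m + 1) t * ∫⁻ y, s.indicator 1 y ∂ρ t x :=
        (measurable_laplaceWeight _ _).mul (hρ.measurable_lintegral_left hf x)
      rw [← lintegral_indicator_one (μ := weightedKernel ρ _ x) hs,
        hρ.lintegral_weightedKernel (by fun_prop) hf,
        ← lintegral_const_mul _ hm]
      refine setLIntegral_congr_fun measurableSet_Ioi fun u hu => ?_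
      simp only [setLIntegral_laplaceWeight_convolution l m hu, mul_assoc]
    rw [hconv h, hconv h'] at key
    refine (ENNReal.mul_le_mul_iff_right ?_ ENNReal.ofReal_ne_top).1 key
    rw [ne_eq, ENNReal.ofReal_eq_zero, not_le]
    positivity

theorem ae_lintegral_le (h : IsMeasurableSemigroup κ M) (h' : IsMeasurableSemigroup κ' M)
    (h0 : ∀ l, 0 < l → ∀ x,
      weightedKernel κ (laplaceWeight l 0) x ≤ weightedKernel κ' (laplaceWeight l 0) x)
    {f : E → ℝ≥0∞} (hf : Measurable f) {C : ℝ≥0} (hC : ∀ x, f x ≤ C) (x : E) :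
    ∀ᵐ t : ℝ, 0 < t → ∫⁻ y, f y ∂κ t x ≤ ∫⁻ y, f y ∂κ' t x := by
  refine ae_le_of_setLIntegral_laplaceWeight_le (h.measurable_lintegral_left hf x)
    (h'.measurable_lintegral_left hf x) (C := C * M)
    (fun t => by simpa using h.lintegral_le hC t x)
    (fun t => by simpa using h'.lintegral_le hC t x) fun j m => ?_
  rw [← h.lintegral_weightedKernel (by fun_prop) hf,
    ← h'.lintegral_weightedKernel (by fun_prop) hf]
  exact lintegral_mono'
    (h.weightedKernel_laplaceWeight_le h' h0 m _ (by positivity) x) le_rfl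

theorem le_of_weightedKernel_le [TopologicalSpace E] [PolishSpace E] [BorelSpace E]
    (h : IsMeasurableSemigroup κ M) (h' : IsMeasurableSemigroup κ' M)
    (hc : ∀ t, 0 < t → ∀ f : E →ᵇ ℝ≥0, ∃ g : E →ᵇ ℝ≥0, ∀ x, ∫⁻ y, f y ∂κ t x = g x)
    (hc' : ∀ t, 0 < t → ∀ f : E →ᵇ ℝ≥0, ∃ g : E →ᵇ ℝ≥0, ∀ x, ∫⁻ y, f y ∂κ' t x = g x)
    (h0 : ∀ l, 0 < l → ∀ x,
      weightedKernel κ (laplaceWeight l 0) x ≤ weightedKernel κ' (laplaceWeight l 0) x)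
    {t : ℝ} (ht : 0 < t) (x : E) : κ t x ≤ κ' t x := by
  have := h.isFiniteMeasure
  have := h'.isFiniteMeasure
  obtain ⟨𝒞, h𝒞c, h𝒞m, h𝒞⟩ := exists_countable_convergence_determining E
  have := h𝒞c.to_subtype
  let Φ : ℝ → (𝒞 → ℝ≥0∞) × (𝒞 → ℝ≥0∞) := fun s => (fun B => κ s x B, fun B => κ' s x B)
  have hΦ : Measurable Φ :=
    (measurable_pi_lambda _ fun B : 𝒞 =>
      (Measure.measurable_coe (h𝒞m B B.2)).comp (h.measurable_left x)).prodMk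
    (measurable_pi_lambda _ fun B : 𝒞 =>
      (Measure.measurable_coe (h𝒞m B B.2)).comp (h'.measurable_left x))
  have hvol : volume (Ioo 0 t) ≠ 0 := by simpa using ht
  obtain ⟨s, hs, hsΦ⟩ := ((frequently_ae_mem_iff.2 hvol).and_eventually
    (ae_exists_seq_tendsto hΦ)).exists
  refine measure_le_of_forall_lintegral_le fun f => ?_
  obtain ⟨g, hg⟩ := hc (t - s) (sub_pos.2 hs.2) f
  obtain ⟨g', hg'⟩ := hc' (t - s) (sub_pos.2 hs.2) f
  have hfm : Measurable fun y => (f y : ℝ≥0∞) := by fun_prop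
  have hgood := h.ae_lintegral_le h' h0 hfm (C := nndist f 0)
    (fun y => by exact_mod_cast BoundedContinuousFunction.NNReal.upper_bound f y) x
  have hshift : ∀ᵐ r : ℝ, 0 < r + (t - s) →
      ∫⁻ y, f y ∂κ (r + (t - s)) x ≤ ∫⁻ y, f y ∂κ' (r + (t - s)) x :=
    (measurePreserving_add_right volume (t - s)).quasiMeasurePreserving.ae hgood
  obtain ⟨u, hu, huΦ, hup⟩ := hsΦ _ hshift
  have hpos : ∀ᶠ n in atTop, 0 < u n := hu.eventually (lt_mem_nhds hs.1)
  have hlim : Tendsto (fun n => ∫⁻ y, g y ∂κ (u n) x) atTop (𝓝 (∫⁻ y, g y ∂κ s x)) :=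
    h𝒞 _ _ (fun B hB => tendsto_pi_nhds.1 ((continuous_fst.tendsto _).comp huΦ) ⟨B, hB⟩) g
  have hlim' : Tendsto (fun n => ∫⁻ y, g' y ∂κ' (u n) x) atTop (𝓝 (∫⁻ y, g' y ∂κ' s x)) :=
    h𝒞 _ _ (fun B hB => tendsto_pi_nhds.1 ((continuous_snd.tendsto _).comp huΦ) ⟨B, hB⟩) g'
  have hκ : ∀ r, 0 < r → ∫⁻ y, f y ∂κ (r + (t - s)) x = ∫⁻ y, g y ∂κ r x := fun r hr => by
    simp_rw [h.lintegral_add hfm hr (sub_pos.2 hs.2), hg]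
  have hκ' : ∀ r, 0 < r → ∫⁻ y, f y ∂κ' (r + (t - s)) x = ∫⁻ y, g' y ∂κ' r x := fun r hr => by
    simp_rw [h'.lintegral_add hfm hr (sub_pos.2 hs.2), hg']
  have hts : t = s + (t - s) := by ring
  rw [hts, hκ s hs.1, hκ' s hs.1]
  refine le_of_tendsto_of_tendsto hlim hlim' ?_
  filter_upwards [hpos] with n hn
  rw [← hκ _ hn, ← hκ' _ hn]
  exact hup n (by linarith [hs.2])

end IsMeasurableSemigroup

/-- Extension of a family of kernels by zero to nonpositive times. -/
noncomputable def zeroExtend {E : Type*} [MeasurableSpace E] (k : ℝ → E → Measure E) (t : ℝ)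
    (x : E) : Measure E :=
  open Classical in if 0 < t then k t x else 0

section

variable {E : Type*} [MeasurableSpace E] {k : ℝ → E → Measure E} {M : ℝ≥0}

theorem zeroExtend_of_pos {t : ℝ} (ht : 0 < t) : zeroExtend k t = k t := by
  funext x; simp [zeroExtend, ht]

namespace IsKernelSemigroup

theorem isFiniteMeasure (h : IsKernelSemigroup k M) {t : ℝ} (ht : 0 < t) (x : E) :
    IsFiniteMeasure (k t x) :=
  ⟨(h.2.1 t ht x).trans_lt ENNReal.coe_lt_top⟩

theorem isMeasurableSemigroup (h : IsKernelSemigroup k M) :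
    IsMeasurableSemigroup (zeroExtend k) M where
  measurable := by
    classical
    refine Measure.measurable_of_measurable_coe _ fun A hA => ?_
    have hs : MeasurableSet {p : ℝ × E | 0 < p.1} := measurableSet_lt measurable_const measurable_fst
    refine measurable_of_restrict_of_restrict_compl hs ?_ ?_
    · have hb : IsBb (A.indicator (1 : E → ℝ)) := ⟨measurable_one.indicator hA, 1, fun x => by
        by_cases hx : x ∈ A <;> simp [hx]⟩
      have hm := (h.2.2.2 _ hb).ennreal_ofReal.comp
        (f := fun p : {p : ℝ × E | 0 < p.1} => (⟨p.1.1, p.2⟩, p.1.2)) (by fun_prop)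
      convert! hm using 1
      funext ⟨⟨t, x⟩, (ht : 0 < t)⟩
      have := h.isFiniteMeasure ht x
      simp [zeroExtend_of_pos ht, kOp, integral_indicator_one hA]
    · convert! (measurable_zero : Measurable (0 : ({p : ℝ × E | 0 < p.1}ᶜ : Set (ℝ × E)) → ℝ≥0∞)) using 1
      funext ⟨⟨t, x⟩, ht⟩
      have ht' : ¬ 0 < t := ht
      simp [zeroExtend, ht']
  mass_le t x := by
    by_cases ht : 0 < t
    · simpa [zeroExtend_of_pos ht] using h.2.1 t ht x
    · simp [zeroExtend, ht]
  eq_zero t ht x := by simp [zeroExtend, ht.not_gt]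
  add t ht s hs x := by
    rw [zeroExtend_of_pos (add_pos ht hs), zeroExtend_of_pos ht, zeroExtend_of_pos hs]
    refine Measure.ext fun A hA => ?_
    rw [h.2.2.1 t ht s hs x A hA, Measure.bind_apply hA
      (Measure.measurable_of_measurable_coe _ (h.1 s hs)).aemeasurable]

theorem ofReal_kOp (h : IsKernelSemigroup k M) {t : ℝ} (ht : 0 < t) {f : E → ℝ} (hf : IsBb f)
    (hf0 : ∀ x, 0 ≤ f x) (x : E) :
    ∫⁻ y, ENNReal.ofReal (f y) ∂k t x = ENNReal.ofReal (kOp (k t) f x) := by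
  have := h.isFiniteMeasure ht x
  obtain ⟨hm, C, hC⟩ := hf
  exact (ofReal_integral_eq_lintegral_ofReal (Integrable.of_bound hm.aestronglyMeasurable C
    (Eventually.of_forall hC)) (Eventually.of_forall hf0)).symm

theorem lintegral_weightedKernel_lt_top (h : IsKernelSemigroup k M) {f : E → ℝ} (hf : IsBb f)
    {l : ℝ} (hl : 0 < l) (x : E) :
    ∫⁻ y, ENNReal.ofReal (f y) ∂weightedKernel (zeroExtend k) (laplaceWeight l 0) x < ∞ := by
  obtain ⟨hm, C, hC⟩ := hf
  rw [h.isMeasurableSemigroup.lintegral_weightedKernel (by fun_prop) hm.ennreal_ofReal]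
  refine setLIntegral_laplaceWeight_zero_mul_lt_top hl (C := C.toNNReal * M) fun t => ?_
  rw [ENNReal.coe_mul]
  exact h.isMeasurableSemigroup.lintegral_le
    (fun y => ENNReal.ofReal_le_ofReal ((le_abs_self _).trans (hC y))) t x

theorem laplaceOp_eq (h : IsKernelSemigroup k M) {f : E → ℝ} (hf : IsBb f)
    (hf0 : ∀ x, 0 ≤ f x) {l : ℝ} (hl : 0 < l) (x : E) :
    laplaceOp k l f x =
      (∫⁻ y, ENNReal.ofReal (f y) ∂weightedKernel (zeroExtend k) (laplaceWeight l 0) x).toReal := by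
  have hs := h.isMeasurableSemigroup
  have hm := hf.1.ennreal_ofReal
  have hlt := h.lintegral_weightedKernel_lt_top hf hl x
  rw [hs.lintegral_weightedKernel (by fun_prop) hm] at hlt ⊢
  have hm2 : Measurable fun t => laplaceWeight l 0 t *
      ∫⁻ y, ENNReal.ofReal (f y) ∂zeroExtend k t x :=
    (measurable_laplaceWeight l 0).mul (hs.measurable_lintegral_left hm x)
  rw [← integral_toReal hm2.aemeasurable (ae_lt_top hm2 hlt.ne)]
  refine setIntegral_congr_fun measurableSet_Ioi fun t ht => ?_
  have hk : 0 ≤ kOp (k t) f x := integral_nonneg hf0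
  simp [zeroExtend_of_pos ht, h.ofReal_kOp ht hf hf0, laplaceWeight, hk, Real.exp_nonneg]

theorem exists_boundedContinuous [TopologicalSpace E] [BorelSpace E] (h : IsKernelSemigroup k M)
    (hcb : ∀ t, 0 < t → ∀ f : E → ℝ, IsCb f → IsCb (kOp (k t) f)) (t : ℝ) (ht : 0 < t)
    (f : E →ᵇ ℝ≥0) : ∃ g : E →ᵇ ℝ≥0, ∀ x, ∫⁻ y, f y ∂zeroExtend k t x = g x := by
  have hC : ∀ x, |(f x : ℝ)| ≤ nndist f 0 := fun x => by
    rw [NNReal.abs_eq]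
    exact_mod_cast BoundedContinuousFunction.NNReal.upper_bound f x
  have hfc : Continuous fun x => (f x : ℝ) := by fun_prop
  obtain ⟨hgc, C, hgC⟩ := hcb t ht (fun x => f x) ⟨hfc, _, hC⟩
  refine ⟨(BoundedContinuousFunction.ofNormedAddCommGroup _ hgc C hgC).nnrealPart, fun x => ?_⟩
  simpa [zeroExtend_of_pos ht, ENNReal.ofReal] using
    h.ofReal_kOp ht ⟨hfc.measurable, _, hC⟩ (fun x => (f x).2) x

end IsKernelSemigroup

end

/-- For a sequence of bounded positive semigroups of kernel operators leaving
`C_b(E)` invariant, the semigroups are increasing in `n` if and only if their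
Laplace transforms are increasing in `n`. -/
theorem semigroups_increasing_iff_laplace_increasing
    {E : Type*} [TopologicalSpace E] [PolishSpace E] [MeasurableSpace E] [BorelSpace E]
    (kseq : ℕ → ℝ → E → Measure E) (M : NNReal)
    (hsg : ∀ n, IsKernelSemigroup (kseq n) M)
    (hcb : ∀ n, ∀ t, 0 < t → ∀ f : E → ℝ, IsCb f → IsCb (kOp (kseq n t) f)) :
    (∀ t, 0 < t → ∀ n, ∀ x, ∀ A : Set E, MeasurableSet A →
        kseq n t x A ≤ kseq (n + 1) t x A) ↔
      (∀ l : ℝ, 0 < l → ∀ n, ∀ f : E → ℝ, IsBb f → (∀ x, 0 ≤ f x) →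
        ∀ x, laplaceOp (kseq n) l f x ≤ laplaceOp (kseq (n + 1)) l f x) := by
  constructor
  · intro h l hl n f hf hf0 x
    rw [(hsg n).laplaceOp_eq hf hf0 hl, (hsg (n + 1)).laplaceOp_eq hf hf0 hl]
    refine ENNReal.toReal_mono ((hsg (n + 1)).lintegral_weightedKernel_lt_top hf hl x).ne ?_
    have hm := hf.1.ennreal_ofReal
    rw [(hsg n).isMeasurableSemigroup.lintegral_weightedKernel (by fun_prop) hm,
      (hsg (n + 1)).isMeasurableSemigroup.lintegral_weightedKernel (by fun_prop) hm]
    refine setLIntegral_mono' measurableSet_Ioi fun t ht => mul_le_mul_right ?_ _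
    rw [zeroExtend_of_pos ht, zeroExtend_of_pos ht]
    exact lintegral_mono' (Measure.le_iff.2 (h t ht n x)) le_rfl
  · intro h t ht n x A _
    have hle := (hsg n).isMeasurableSemigroup.le_of_weightedKernel_le
      (hsg (n + 1)).isMeasurableSemigroup ((hsg n).exists_boundedContinuous (hcb n))
      ((hsg (n + 1)).exists_boundedContinuous (hcb (n + 1))) (fun l hl x => ?_) ht x
    · rw [zeroExtend_of_pos ht, zeroExtend_of_pos ht] at hle
      exact hle A
    refine Measure.le_iff.2 fun s hs => ?_
    have hb : IsBb (s.indicator (1 : E → ℝ)) := ⟨measurable_one.indicator hs, 1, fun x => by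
      by_cases hx : x ∈ s <;> simp [hx]⟩
    have hb0 : ∀ x, 0 ≤ s.indicator (1 : E → ℝ) x := fun x =>
      indicator_nonneg (fun _ _ => zero_le_one) x
    have key := h l hl n _ hb hb0 x
    rw [(hsg n).laplaceOp_eq hb hb0 hl, (hsg (n + 1)).laplaceOp_eq hb hb0 hl,
      ENNReal.toReal_le_toReal ((hsg n).lintegral_weightedKernel_lt_top hb hl x).ne
        ((hsg (n + 1)).lintegral_weightedKernel_lt_top hb hl x).ne] at key
    have hind : ∀ y, ENNReal.ofReal (s.indicator (1 : E → ℝ) y) = s.indicator 1 y := fun y => by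
      by_cases hy : y ∈ s <;> simp [hy]
    simpa only [hind, lintegral_indicator_one hs] using key
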